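/- Let K be a field of characteristic zero and let G be a Noetherian Lie algebra over K, i.e. G is weakly Noetherian and every ascending chain of characteristic ideals of G stabilizes. Let a be a Lie ideal of G. Then a, regarded as a Lie algebra, satisfies the ascending chain condition on its Lie ideals: every ascending chain m₁ ⊆ m₂ ⊆ ⋯ of Lie ideals of a stabilizes. -/

import Mathlib

/-- A Lie algebra is weakly Noetherian if `m/[m,m]` is finite dimensional over `K` for every
Lie subalgebra `m`. -/
def WeaklyNoetherian (K G : Type*) [Field K] [LieRing G] [LieAlgebra K G] : Prop :=
  ∀ m : LieSubalgebra K G,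
    FiniteDimensional K (↥m ⧸ LieAlgebra.derivedSeries K ↥m 1)

/-- An ideal is characteristic if it is preserved by every derivation. -/
def IsCharacteristicIdeal (K G : Type*) [Field K] [LieRing G] [LieAlgebra K G]
    (m : LieIdeal K G) : Prop :=
  ∀ D : LieDerivation K G G, ∀ x ∈ m, D x ∈ m

/-- A Lie algebra is Noetherian if it is weakly Noetherian and every ascending chain of
characteristic ideals stabilizes. -/
def LieNoetherian (K G : Type*) [Field K] [LieRing G] [LieAlgebra K G] : Prop :=
  WeaklyNoetherian K G ∧
    ∀ c : ℕ → LieIdeal K G, Monotone c → (∀ k, IsCharacteristicIdeal K G (c k)) →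
      ∃ N, ∀ k, N ≤ k → c k = c N

section FiniteComplement

variable {K : Type*} [Field K]

/-- A linear map to a finite dimensional space has a finite dimensional supplement to its kernel. -/
theorem LinearMap.exists_fg_sup_ker_eq_top {E F : Type*} [AddCommGroup E] [Module K E]
    [AddCommGroup F] [Module K F] [FiniteDimensional K F] (φ : E →ₗ[K] F) :
    ∃ V : Submodule K E, V.FG ∧ V ⊔ LinearMap.ker φ = ⊤ := by
  obtain ⟨V, hV⟩ := (LinearMap.ker φ).exists_isCompl
  refine ⟨V, ?_, hV.symm.sup_eq_top⟩
  have hinj : Function.Injective (φ ∘ₗ V.subtype) := by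
    rw [← LinearMap.ker_eq_bot, LinearMap.ker_comp]
    exact Submodule.disjoint_iff_comap_eq_bot.mp hV.symm.disjoint
  have : FiniteDimensional K V := FiniteDimensional.of_injective _ hinj
  exact Module.Finite.iff_fg.mp this

end FiniteComplement

section Closure

variable {K L : Type*} [Field K] [LieRing L] [LieAlgebra K L]

/-- In a weakly Noetherian Lie algebra, a subalgebra is finite dimensional modulo any submodule
containing all its brackets. -/
theorem WeaklyNoetherian.exists_fg_le_sup (h : WeaklyNoetherian K L) (B : LieSubalgebra K L) :
    ∃ W : Submodule K L, W.FG ∧ W ≤ B.toSubmodule ∧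
      ∀ N : Submodule K L, (∀ u ∈ B, ∀ v ∈ B, ⁅u, v⁆ ∈ N) → B.toSubmodule ≤ W ⊔ N := by
  have hB : FiniteDimensional K (B ⧸ (LieAlgebra.derivedSeries K B 1).toSubmodule) := h B
  obtain ⟨V, hVfg, hV⟩ :=
    (LieAlgebra.derivedSeries K B 1).toSubmodule.mkQ.exists_fg_sup_ker_eq_top
  rw [Submodule.ker_mkQ] at hV
  refine ⟨V.map B.toSubmodule.subtype, hVfg.map _, Submodule.map_subtype_le _ _, ?_⟩
  intro N hN x hx
  have hxV : (⟨x, hx⟩ : B) ∈ V ⊔ (LieAlgebra.derivedSeries K B 1).toSubmodule := by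
    rw [hV]; trivial
  obtain ⟨y, hy, z, hz, hyz⟩ := Submodule.mem_sup.mp hxV
  have hzN : (LieAlgebra.derivedSeries K B 1).toSubmodule ≤ N.comap B.toSubmodule.subtype := by
    rw [show LieAlgebra.derivedSeries K B 1 = ⁅(⊤ : LieIdeal K B), (⊤ : LieIdeal K B)⁆ from rfl,
      LieSubmodule.lieIdeal_oper_eq_linear_span, Submodule.span_le]
    rintro _ ⟨u, v, rfl⟩
    exact hN _ u.1.2 _ v.1.2
  exact Submodule.mem_sup.mpr ⟨y, ⟨y, hy, rfl⟩, z, hzN hz, congrArg Subtype.val hyz⟩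

theorem WeaklyNoetherian.of_exists_fg (h : ∀ B : LieSubalgebra K L, ∃ W : Submodule K L, W.FG ∧
    W ≤ B.toSubmodule ∧
      ∀ N : Submodule K L, (∀ u ∈ B, ∀ v ∈ B, ⁅u, v⁆ ∈ N) → B.toSubmodule ≤ W ⊔ N) :
    WeaklyNoetherian K L := by
  intro B
  obtain ⟨W, hWfg, hWB, hW⟩ := h B
  have : FiniteDimensional K W := Module.Finite.iff_fg.mpr hWfg
  let D := (LieAlgebra.derivedSeries K B 1).toSubmodule
  let f : W →ₗ[K] B ⧸ D := D.mkQ ∘ₗ Submodule.inclusion hWB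
  refine Module.Finite.of_surjective f fun q => ?_
  obtain ⟨x, rfl⟩ := D.mkQ_surjective q
  have hx := hW (D.map B.toSubmodule.subtype) (fun u hu v hv => ⟨⁅(⟨u, hu⟩ : B), ⟨v, hv⟩⁆,
    LieSubmodule.lie_mem_lie (LieSubmodule.mem_top _) (LieSubmodule.mem_top _), rfl⟩) x.2
  obtain ⟨w, hw, _, ⟨z, hz, rfl⟩, hwz⟩ := Submodule.mem_sup.mp hx
  refine ⟨⟨w, hw⟩, ?_⟩
  refine ((Submodule.Quotient.eq D).mpr ?_).symm
  have hxz : x - Submodule.inclusion hWB ⟨w, hw⟩ = z := by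
    apply Subtype.ext
    change (x : L) - w = z
    rw [← hwz]
    exact add_sub_cancel_left _ _
  rw [hxz]
  exact hz

/-- Weak Noetherianity passes to ideals. -/
theorem WeaklyNoetherian.lieIdeal (h : WeaklyNoetherian K L) (a : LieIdeal K L) :
    WeaklyNoetherian K a := by
  refine WeaklyNoetherian.of_exists_fg fun B => ?_
  obtain ⟨W, hWfg, hWB, hW⟩ := h.exists_fg_le_sup (B.map (LieIdeal.incl a))
  have hWa : (W.comap a.toSubmodule.subtype).map a.toSubmodule.subtype = W := by
    refine Submodule.map_comap_eq_self fun w hw => ?_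
    obtain ⟨b, -, rfl⟩ := hWB hw
    exact ⟨b, rfl⟩
  refine ⟨W.comap a.toSubmodule.subtype, ?_, ?_, ?_⟩
  · refine Submodule.fg_of_fg_map_injective _ a.toSubmodule.injective_subtype ?_
    rwa [hWa]
  · intro x hx
    obtain ⟨b, hb, hbx⟩ := hWB hx
    rwa [← (Subtype.ext hbx : b = x)]
  · intro N hN x hx
    have := hW (N.map a.toSubmodule.subtype) ?_ (x := (x : L)) ⟨x, hx, rfl⟩
    · rw [← hWa, ← Submodule.map_sup] at this
      obtain ⟨y, hy, hyx⟩ := this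
      rwa [← (Subtype.ext hyx : y = x)]
    · rintro _ ⟨u, hu, rfl⟩ _ ⟨v, hv, rfl⟩
      exact ⟨⁅u, v⁆, hN u hu v hv, rfl⟩

/-- `I` is finite dimensional modulo `m`. -/
def FGModulo (m I : LieIdeal K L) : Prop :=
  (I.toSubmodule.map m.toSubmodule.mkQ).FG

theorem FGModulo.sup {m I J : LieIdeal K L} (hI : FGModulo m I) (hJ : FGModulo m J) :
    FGModulo m (I ⊔ J) := by
  unfold FGModulo at *
  rw [LieSubmodule.sup_toSubmodule, Submodule.map_sup]
  exact Submodule.FG.sup hI hJ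

theorem FGModulo.self (m : LieIdeal K L) : FGModulo m m := by
  unfold FGModulo
  rw [Submodule.mkQ_map_self]
  exact Submodule.fg_bot

theorem Submodule.fg_of_le {E : Type*} [AddCommGroup E] [Module K E] {U V : Submodule K E}
    (hV : V.FG) (h : U ≤ V) : U.FG := by
  have : FiniteDimensional K V := Module.Finite.iff_fg.mpr hV
  have := Submodule.finiteDimensional_of_le h
  exact Module.Finite.iff_fg.mp this

theorem FGModulo.of_le_sup {m I : LieIdeal K L} {V : Submodule K L} (hV : V.FG)
    (h : I.toSubmodule ≤ V ⊔ m.toSubmodule) : FGModulo m I := by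
  refine Submodule.fg_of_le (hV.map m.toSubmodule.mkQ) ((Submodule.map_mono h).trans ?_)
  rw [Submodule.map_sup, Submodule.mkQ_map_self, sup_bot_eq]

theorem FGModulo.exists_le_sup {m I : LieIdeal K L} (h : FGModulo m I) :
    ∃ V : Submodule K L, V.FG ∧ I.toSubmodule ≤ V ⊔ m.toSubmodule := by
  have hfin : FiniteDimensional K (I.toSubmodule.map m.toSubmodule.mkQ) :=
    Module.Finite.iff_fg.mpr h
  obtain ⟨V, hVfg, hV⟩ := LinearMap.exists_fg_sup_ker_eq_top
    ((m.toSubmodule.mkQ ∘ₗ I.toSubmodule.subtype).codRestrict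
      (I.toSubmodule.map m.toSubmodule.mkQ) fun x => ⟨x, x.2, rfl⟩)
  refine ⟨V.map I.toSubmodule.subtype, hVfg.map _, fun x hx => ?_⟩
  have hxV := hV.ge (Submodule.mem_top (x := (⟨x, hx⟩ : I.toSubmodule)))
  obtain ⟨y, hy, z, hz, hyz⟩ := Submodule.mem_sup.mp hxV
  refine Submodule.mem_sup.mpr ⟨y, ⟨y, hy, rfl⟩, z, ?_, congrArg Subtype.val hyz⟩
  exact (Submodule.Quotient.mk_eq_zero _).mp (congrArg Subtype.val (LinearMap.mem_ker.mp hz))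

/-- The sum of all ideals that are finite dimensional modulo `m`. -/
def finiteHull (m : LieIdeal K L) : LieIdeal K L := sSup {I | FGModulo m I}

theorem FGModulo.le_finiteHull {m I : LieIdeal K L} (h : FGModulo m I) : I ≤ finiteHull m :=
  le_sSup h

theorem exists_fgModulo_of_mem_finiteHull {m : LieIdeal K L} {x : L} (hx : x ∈ finiteHull m) :
    ∃ I, FGModulo m I ∧ x ∈ I := by
  rw [finiteHull, ← LieSubmodule.mem_toSubmodule, LieSubmodule.sSup_toSubmodule,
    Submodule.mem_sSup_of_directed] at hx
  · obtain ⟨_, ⟨I, hI, rfl⟩, hxI⟩ := hx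
    exact ⟨I, hI, hxI⟩
  · exact ⟨_, m, FGModulo.self m, rfl⟩
  · rintro _ ⟨I, hI, rfl⟩ _ ⟨J, hJ, rfl⟩
    exact ⟨_, ⟨I ⊔ J, hI.sup hJ, rfl⟩, (le_sup_left : I ≤ I ⊔ J), (le_sup_right : J ≤ I ⊔ J)⟩

theorem exists_fgModulo_of_fg_le_finiteHull {m : LieIdeal K L} {W : Submodule K L} (hW : W.FG)
    (hle : W ≤ (finiteHull m).toSubmodule) : ∃ I, FGModulo m I ∧ W ≤ I.toSubmodule := by
  induction W, hW using Submodule.fg_induction with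
  | singleton x =>
    obtain ⟨I, hI, hx⟩ := exists_fgModulo_of_mem_finiteHull
      (hle (Submodule.mem_span_singleton_self x))
    exact ⟨I, hI, (Submodule.span_singleton_le_iff_mem _ _).mpr hx⟩
  | sup U V _ _ ihU ihV =>
    obtain ⟨I, hI, hUI⟩ := ihU (le_sup_left.trans hle)
    obtain ⟨J, hJ, hVJ⟩ := ihV (le_sup_right.trans hle)
    exact ⟨I ⊔ J, hI.sup hJ, sup_le (hUI.trans (le_sup_left : I ≤ I ⊔ J))
      (hVJ.trans (le_sup_right : J ≤ I ⊔ J))⟩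

/-- Among the submodules between an ideal `m` and a submodule `S ≥ m`, there is a maximal one that
is commutative modulo `m`. -/
theorem exists_maximal_abelian_modulo (m : LieIdeal K L) (S : Submodule K L)
    (hmS : m.toSubmodule ≤ S) :
    ∃ A : Submodule K L, m.toSubmodule ≤ A ∧ A ≤ S ∧ (∀ u ∈ A, ∀ v ∈ A, ⁅u, v⁆ ∈ m) ∧
      ∀ x ∈ S, (∀ u ∈ A, ⁅x, u⁆ ∈ m) → x ∈ A := by
  obtain ⟨A, hmA, hA⟩ := zorn_le_nonempty₀
    {A : Submodule K L | A ≤ S ∧ ∀ u ∈ A, ∀ v ∈ A, ⁅u, v⁆ ∈ m} (fun c hc hchain y hy => by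
      refine ⟨sSup c, ⟨sSup_le fun A hA => (hc hA).1, fun u hu v hv => ?_⟩, fun A hA => le_sSup hA⟩
      rw [Submodule.mem_sSup_of_directed ⟨y, hy⟩ hchain.directedOn] at hu hv
      obtain ⟨A, hA, hu⟩ := hu
      obtain ⟨B, hB, hv⟩ := hv
      rcases hchain.total hA hB with hAB | hBA
      · exact (hc hB).2 u (hAB hu) v hv
      · exact (hc hA).2 u hu v (hBA hv))
    m.toSubmodule ⟨hmS, fun u _ v hv => m.lie_mem hv⟩
  refine ⟨A, hmA, hA.prop.1, hA.prop.2, fun x hxS hx => ?_⟩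
  have hle : A ⊔ Submodule.span K {x} ≤ A := by
    refine hA.le_of_ge ⟨sup_le hA.prop.1 ((Submodule.span_singleton_le_iff_mem _ _).mpr hxS), ?_⟩
      le_sup_left
    intro u hu v hv
    obtain ⟨u, huA, _, hr, rfl⟩ := Submodule.mem_sup.mp hu
    obtain ⟨r, rfl⟩ := Submodule.mem_span_singleton.mp hr
    obtain ⟨v, hvA, _, hs, rfl⟩ := Submodule.mem_sup.mp hv
    obtain ⟨s, rfl⟩ := Submodule.mem_span_singleton.mp hs
    have hux : ⁅u, x⁆ ∈ m := by
      rw [← lie_skew]; exact m.neg_mem (hx u huA)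
    simp only [add_lie, lie_add, smul_lie, lie_smul, lie_self, smul_zero, add_zero]
    exact m.add_mem (m.add_mem (hA.prop.2 u huA v hvA) (m.smul_mem _ (hx v hvA)))
      (m.smul_mem _ hux)
  exact hle (Submodule.mem_sup_right (Submodule.mem_span_singleton_self x))

/-- In a weakly Noetherian Lie algebra, the sum of all ideals that are finite dimensional modulo
`m` is finite dimensional modulo `m`. -/
theorem WeaklyNoetherian.fgModulo_finiteHull (h : WeaklyNoetherian K L) (m : LieIdeal K L) :
    FGModulo m (finiteHull m) := by
  obtain ⟨A, hmA, hAS, hAm, hAmax⟩ := exists_maximal_abelian_modulo m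
    (finiteHull m).toSubmodule (FGModulo.self m).le_finiteHull
  obtain ⟨W, hWfg, hWA, hW⟩ := h.exists_fg_le_sup
    { A with lie_mem' := fun {u v} hu hv => hmA (hAm u hu v hv) }
  have hAW : A ≤ W ⊔ m.toSubmodule := hW m.toSubmodule hAm
  obtain ⟨I, hI, hWI⟩ := exists_fgModulo_of_fg_le_finiteHull hWfg (hWA.trans hAS)
  have : FiniteDimensional K (I.toSubmodule.map m.toSubmodule.mkQ) := Module.Finite.iff_fg.mpr hI
  have : FiniteDimensional K W := Module.Finite.iff_fg.mpr hWfg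
  let φ : (finiteHull m).toSubmodule →ₗ[K] W →ₗ[K] I.toSubmodule.map m.toSubmodule.mkQ :=
    LinearMap.mk₂ K (fun s w => ⟨m.toSubmodule.mkQ ⁅(s : L), (w : L)⁆, ⁅(s : L), (w : L)⁆,
        I.lie_mem (hWI w.2), rfl⟩)
      (fun s t w => Subtype.ext (by simp [add_lie]))
      (fun r s w => Subtype.ext (by simp))
      (fun s v w => Subtype.ext (by simp))
      (fun r s w => Subtype.ext (by simp))
  obtain ⟨V, hVfg, hV⟩ := LinearMap.exists_fg_sup_ker_eq_top (K := K)
    (E := (finiteHull m).toSubmodule) (F := W →ₗ[K] I.toSubmodule.map m.toSubmodule.mkQ) φ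
  refine FGModulo.of_le_sup ((hVfg.map (finiteHull m).toSubmodule.subtype).sup hWfg)
    fun x hx => ?_
  obtain ⟨y, hy, z, hz, hyz⟩ := Submodule.mem_sup.mp
    (hV.ge (Submodule.mem_top (x := (⟨x, hx⟩ : (finiteHull m).toSubmodule))))
  have hzA : (z : L) ∈ A := by
    refine hAmax z z.2 fun u hu => ?_
    obtain ⟨w, hw, n, hn, rfl⟩ := Submodule.mem_sup.mp (hAW hu)
    rw [lie_add]
    refine m.add_mem ?_ (m.lie_mem hn)
    have := congrArg Subtype.val (LinearMap.congr_fun (LinearMap.mem_ker.mp hz) ⟨w, hw⟩)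
    exact (Submodule.Quotient.mk_eq_zero _).mp this
  rw [sup_assoc]
  exact Submodule.mem_sup.mpr ⟨y, ⟨y, hy, rfl⟩, z, hAW hzA, congrArg Subtype.val hyz⟩

/-- The ideal `I + D(I)`. -/
def LieIdeal.supDerivation (I : LieIdeal K L) (D : LieDerivation K L L) : LieIdeal K L where
  __ := I.toSubmodule ⊔ I.toSubmodule.map (D : L →ₗ[K] L)
  lie_mem := by
    intro x y hy
    obtain ⟨u, hu, _, ⟨v, hv, rfl⟩, rfl⟩ := Submodule.mem_sup.mp hy
    refine Submodule.mem_sup.mpr ⟨⁅x, u⁆ - ⁅D x, v⁆, I.sub_mem (I.lie_mem hu) (I.lie_mem hv),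
      D ⁅x, v⁆, ⟨_, I.lie_mem hv, rfl⟩, ?_⟩
    rw [lie_add, LieDerivation.apply_lie_eq_add]
    change _ = ⁅x, u⁆ + ⁅x, D v⁆
    abel

/-- In a weakly Noetherian Lie algebra, finite hulls are characteristic. -/
theorem WeaklyNoetherian.isCharacteristicIdeal_finiteHull (h : WeaklyNoetherian K L)
    (m : LieIdeal K L) : IsCharacteristicIdeal K L (finiteHull m) := by
  intro D x hx
  let M := finiteHull m
  obtain ⟨V, hVfg, hV⟩ := (h.fgModulo_finiteHull m).exists_le_sup
  obtain ⟨W, hWfg, -, hW⟩ := h.exists_fg_le_sup (LieIdeal.toLieSubalgebra K L M)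
  have hDM : M.toSubmodule.map (D : L →ₗ[K] L) ≤ W.map (D : L →ₗ[K] L) ⊔ M.toSubmodule := by
    rintro _ ⟨y, hy, rfl⟩
    obtain ⟨w, hw, z, hz, rfl⟩ := Submodule.mem_sup.mp
      (hW (M.toSubmodule.comap (D : L →ₗ[K] L)) (fun u hu v hv => by
        change D ⁅u, v⁆ ∈ M
        rw [LieDerivation.apply_lie_eq_add, ← lie_skew u]
        exact M.add_mem (M.neg_mem (M.lie_mem hu)) (M.lie_mem hv)) hy)
    rw [map_add]
    exact Submodule.mem_sup.mpr ⟨_, ⟨w, hw, rfl⟩, _, hz, rfl⟩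
  have hJ : FGModulo m (M.supDerivation D) := by
    refine FGModulo.of_le_sup (hVfg.sup (hWfg.map (D : L →ₗ[K] L))) ?_
    have hM' : M.toSubmodule ≤ V ⊔ W.map (D : L →ₗ[K] L) ⊔ m.toSubmodule :=
      hV.trans (sup_le_sup_right le_sup_left _)
    exact sup_le hM' (hDM.trans (sup_le (le_sup_right.trans le_sup_left) hM'))
  exact hJ.le_finiteHull (Submodule.mem_sup_right ⟨x, hx, rfl⟩)

theorem finiteHull_mono {m n : LieIdeal K L} (hmn : m ≤ n) : finiteHull m ≤ finiteHull n := by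
  refine sSup_le fun I hI => FGModulo.le_finiteHull ?_
  obtain ⟨V, hV, hle⟩ := FGModulo.exists_le_sup hI
  exact FGModulo.of_le_sup hV (hle.trans (sup_le_sup_left (show m.toSubmodule ≤ n.toSubmodule from hmn) V))

theorem FGModulo.stabilizes {I : LieIdeal K L} {m : ℕ → LieIdeal K L} (hm : Monotone m) {N : ℕ}
    (hI : FGModulo (m N) I) (hle : ∀ k, m k ≤ I) : ∃ M, ∀ k, M ≤ k → m k = m M := by
  have hfin : FiniteDimensional K (I.toSubmodule.map (m N).toSubmodule.mkQ) :=
    Module.Finite.iff_fg.mpr hI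
  let f : ℕ →o Submodule K (I.toSubmodule.map (m N).toSubmodule.mkQ) :=
    ⟨fun k => ((m k).toSubmodule.map (m N).toSubmodule.mkQ).comap (Submodule.subtype _),
      fun i j hij => Submodule.comap_mono (Submodule.map_mono (hm hij))⟩
  obtain ⟨M, hM⟩ := monotone_stabilizes_iff_noetherian.mpr inferInstance f
  have key : ∀ k, max N M ≤ k → m k ≤ m (max N M) := by
    intro k hk x hx
    have hxf : (⟨(m N).toSubmodule.mkQ x, x, hle k hx, rfl⟩ :
        I.toSubmodule.map (m N).toSubmodule.mkQ) ∈ f k := ⟨x, hx, rfl⟩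
    rw [← hM k ((le_max_right _ _).trans hk)] at hxf
    obtain ⟨y, hy, hyx⟩ := hxf
    have hsub : y - x ∈ m N := (Submodule.Quotient.eq _).mp hyx
    rw [← sub_sub_cancel y x]
    exact (m (max N M)).sub_mem (hm (le_max_right _ _) hy) (hm (le_max_left _ _) hsub)
  exact ⟨max N M, fun k hk => le_antisymm (key k hk) (hm hk)⟩

/-- In a weakly Noetherian Lie algebra, the ascending chain condition on characteristic ideals
implies the ascending chain condition on all ideals. -/
theorem WeaklyNoetherian.stabilizes (h : WeaklyNoetherian K L)
    (hacc : ∀ c : ℕ → LieIdeal K L, Monotone c → (∀ k, IsCharacteristicIdeal K L (c k)) →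
      ∃ N, ∀ k, N ≤ k → c k = c N)
    (m : ℕ → LieIdeal K L) (hm : Monotone m) : ∃ N, ∀ k, N ≤ k → m k = m N := by
  obtain ⟨N, hN⟩ := hacc (fun k => finiteHull (m k)) (fun i j hij => finiteHull_mono (hm hij))
    fun k => h.isCharacteristicIdeal_finiteHull (m k)
  refine FGModulo.stabilizes hm (h.fgModulo_finiteHull (m N)) fun k => ?_
  rw [← hN (max N k) (le_max_left _ _)]
  exact (hm (le_max_right _ _)).trans (FGModulo.self _).le_finiteHull

/-- The derivation of an ideal induced by the adjoint action of an element. -/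
def LieIdeal.adDerivation (a : LieIdeal K L) (x : L) : LieDerivation K a a where
  toFun y := ⁅x, y⁆
  map_add' := lie_add x
  map_smul' r y := lie_smul r x y
  leibniz' y z := Subtype.ext (by
    change ⁅x, ⁅(y : L), (z : L)⁆⁆ = ⁅(y : L), ⁅x, (z : L)⁆⁆ - ⁅(z : L), ⁅x, (y : L)⁆⁆
    rw [leibniz_lie x, ← lie_skew (z : L)]
    abel)

/-- A characteristic ideal of an ideal, as an ideal of the ambient Lie algebra. -/
def IsCharacteristicIdeal.toLieIdeal {a : LieIdeal K L} {c : LieIdeal K a}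
    (hc : IsCharacteristicIdeal K a c) : LieIdeal K L where
  __ := c.toSubmodule.map a.toSubmodule.subtype
  lie_mem := by
    rintro x _ ⟨y, hy, rfl⟩
    exact ⟨a.adDerivation x y, hc (a.adDerivation x) y hy, rfl⟩

end Closure

/-- Every Lie ideal of a Noetherian Lie algebra satisfies the ascending
chain condition on its own Lie ideals. -/
theorem lieNoetherian_ideal_acc_on_ideals
    (K G : Type*) [Field K] [CharZero K] [LieRing G] [LieAlgebra K G]
    (hG : LieNoetherian K G) (a : LieIdeal K G)
    (m : ℕ → LieIdeal K ↥a) (hmono : Monotone m) :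
    ∃ N, ∀ k, N ≤ k → m k = m N := by
  refine (hG.1.lieIdeal a).stabilizes (fun c hc hchar => ?_) m hmono
  obtain ⟨N, hN⟩ := hG.1.stabilizes hG.2 (fun k => (hchar k).toLieIdeal)
    fun i j hij => Submodule.map_mono (hc hij)
  refine ⟨N, fun k hk => LieSubmodule.toSubmodule_injective ?_⟩
  exact Submodule.map_injective_of_injective a.toSubmodule.injective_subtype
    (congrArg LieSubmodule.toSubmodule (hN k hk))
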